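/- Evolution of the ensemble mean: along any solution of the continuous-time EnKF flow with y = A u†, the ensemble mean ū(t) = (1/J)Σ_j u^{(j)}(t) satisfies dū/dt = −(1/J) Σ_{k=1}^J ⟨A(ū(t) − u†), A e^{(k)}(t)⟩_Γ e^{(k)}(t). -/

import Mathlib

open scoped BigOperators
open RealInnerProductSpace Matrix

noncomputable section

/-- The Γ-weighted inner product `⟨a,b⟩_Γ = ⟨Γ⁻¹ a, b⟩` on `ℝ^K`. -/
def gInner {K : ℕ} (Γ : Matrix (Fin K) (Fin K) ℝ)
    (a b : EuclideanSpace ℝ (Fin K)) : ℝ :=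
  ⟪Matrix.toEuclideanLin Γ⁻¹ a, b⟫

/-- Ensemble mean. -/
def ensMean {X : Type*} [AddCommGroup X] [Module ℝ X] {J : ℕ} (v : Fin J → X) : X :=
  (J : ℝ)⁻¹ • ∑ j, v j

/-- Right-hand side of the continuous-time EnKF flow. -/
def enkfRHS {X : Type*} [NormedAddCommGroup X] [InnerProductSpace ℝ X] {K J : ℕ}
    (A : X →L[ℝ] EuclideanSpace ℝ (Fin K)) (Γ : Matrix (Fin K) (Fin K) ℝ)
    (y : EuclideanSpace ℝ (Fin K)) (v : Fin J → X) (j : Fin J) : X :=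
  (J : ℝ)⁻¹ • ∑ k, gInner Γ (A (v k - ensMean v)) (y - A (v j)) • (v k - ensMean v)

/-- `u : ℝ → Fin J → X` solves the continuous-time EnKF flow on `[0,∞)`. -/
def IsEnKFSolution {X : Type*} [NormedAddCommGroup X] [InnerProductSpace ℝ X] {K J : ℕ}
    (A : X →L[ℝ] EuclideanSpace ℝ (Fin K)) (Γ : Matrix (Fin K) (Fin K) ℝ)
    (y : EuclideanSpace ℝ (Fin K)) (u : ℝ → Fin J → X) : Prop :=
  ∀ j : Fin J, ∀ t ∈ Set.Ici (0 : ℝ),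
    HasDerivWithinAt (fun s => u s j) (enkfRHS A Γ y (u t) j) (Set.Ici 0) t

/-- The deviation Gram matrix `E` of an ensemble. -/
def matE {X : Type*} [NormedAddCommGroup X] [InnerProductSpace ℝ X] {K J : ℕ}
    (A : X →L[ℝ] EuclideanSpace ℝ (Fin K)) (Γ : Matrix (Fin K) (Fin K) ℝ)
    (v : Fin J → X) : Matrix (Fin J) (Fin J) ℝ :=
  Matrix.of fun l j => gInner Γ (A (v l - ensMean v)) (A (v j - ensMean v))

/-- The residual/deviation cross Gram matrix `F` of an ensemble. -/
def matF {X : Type*} [NormedAddCommGroup X] [InnerProductSpace ℝ X] {K J : ℕ}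
    (A : X →L[ℝ] EuclideanSpace ℝ (Fin K)) (Γ : Matrix (Fin K) (Fin K) ℝ)
    (udag : X) (v : Fin J → X) : Matrix (Fin J) (Fin J) ℝ :=
  Matrix.of fun l j => gInner Γ (A (v l - udag)) (A (v j - ensMean v))

/-- The residual Gram matrix `R` of an ensemble. -/
def matR {X : Type*} [NormedAddCommGroup X] [InnerProductSpace ℝ X] {K J : ℕ}
    (A : X →L[ℝ] EuclideanSpace ℝ (Fin K)) (Γ : Matrix (Fin K) (Fin K) ℝ)
    (udag : X) (v : Fin J → X) : Matrix (Fin J) (Fin J) ℝ :=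
  Matrix.of fun l j => gInner Γ (A (v l - udag)) (A (v j - udag))

/-- The orthogonal complement of a subspace of `ℝ^K` w.r.t. the Γ-weighted inner product. -/
def gOrth {K : ℕ} (Γ : Matrix (Fin K) (Fin K) ℝ)
    (S : Submodule ℝ (EuclideanSpace ℝ (Fin K))) :
    Submodule ℝ (EuclideanSpace ℝ (Fin K)) where
  carrier := {w | ∀ v ∈ S, gInner Γ v w = 0}
  add_mem' := by
    intro a b ha hb v hv
    have h1 := ha v hv
    have h2 := hb v hv
    simp only [gInner, Set.mem_setOf_eq] at *
    rw [inner_add_right, h1, h2, add_zero]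
  zero_mem' := by
    intro v hv
    simp [gInner]
  smul_mem' := by
    intro c a ha v hv
    have h1 := ha v hv
    simp only [gInner, Set.mem_setOf_eq] at *
    rw [inner_smul_right, h1, mul_zero]

/-- The orthogonal complement of a subspace of `X` w.r.t. the inner product
`⟨v,w⟩_* = ⟨A v, A w⟩_Γ`. -/
def gOrthX {X : Type*} [NormedAddCommGroup X] [InnerProductSpace ℝ X] {K : ℕ}
    (A : X →L[ℝ] EuclideanSpace ℝ (Fin K)) (Γ : Matrix (Fin K) (Fin K) ℝ)
    (S : Submodule ℝ X) : Submodule ℝ X where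
  carrier := {w | ∀ v ∈ S, gInner Γ (A v) (A w) = 0}
  add_mem' := by
    intro a b ha hb v hv
    have h1 := ha v hv
    have h2 := hb v hv
    simp only [gInner, Set.mem_setOf_eq, map_add] at *
    rw [inner_add_right, h1, h2, add_zero]
  zero_mem' := by
    intro v hv
    simp [gInner]
  smul_mem' := by
    intro c a ha v hv
    have h1 := ha v hv
    simp only [gInner, Set.mem_setOf_eq, _root_.map_smul] at *
    rw [inner_smul_right, h1, mul_zero]


theorem gInner_comm_aux {K : ℕ} {Γ : Matrix (Fin K) (Fin K) ℝ} (hΓ : Γ.PosDef)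
    (a b : EuclideanSpace ℝ (Fin K)) : gInner Γ a b = gInner Γ b a := by
  have h := Matrix.isSymmetric_toEuclideanLin_iff.mpr hΓ.inv.isHermitian
  unfold gInner
  rw [h a b, real_inner_comm]

theorem gInner_mean_aux {X : Type*} [NormedAddCommGroup X] [InnerProductSpace ℝ X]
    {K J : ℕ} (hJ : 0 < J) (A : X →L[ℝ] EuclideanSpace ℝ (Fin K))
    (Γ : Matrix (Fin K) (Fin K) ℝ) (udag : X) (v : Fin J → X)
    (a : EuclideanSpace ℝ (Fin K)) :
    (J : ℝ)⁻¹ * ∑ j, gInner Γ a (A udag - A (v j)) =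
      - gInner Γ a (A (ensMean v - udag)) := by
  have hJ' : (J : ℝ) ≠ 0 := by positivity
  simp only [gInner, ensMean, inner_sub_right, map_sub, _root_.map_smul, map_sum,
    inner_smul_right, inner_sum, Finset.sum_sub_distrib, Finset.sum_const,
    Finset.card_univ, Fintype.card_fin, nsmul_eq_mul]
  field_simp
  ring

theorem enkf_mean_evolution
    {X : Type*} [NormedAddCommGroup X] [InnerProductSpace ℝ X]
    {K J : ℕ} (hJ : 0 < J)
    (A : X →L[ℝ] EuclideanSpace ℝ (Fin K))
    (Γ : Matrix (Fin K) (Fin K) ℝ) (hΓ : Γ.PosDef)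
    (udag : X) (u : ℝ → Fin J → X)
    (hu : IsEnKFSolution A Γ (A udag) u) :
    ∀ t ∈ Set.Ici (0 : ℝ),
      HasDerivWithinAt (fun s => ensMean (u s))
        (-((J : ℝ)⁻¹ • ∑ k,
          gInner Γ (A (ensMean (u t) - udag)) (A (u t k - ensMean (u t))) •
            (u t k - ensMean (u t))))
        (Set.Ici 0) t := by
  intro t ht
  have h1 := (HasDerivWithinAt.fun_sum (u := Finset.univ)
    (fun j _ => hu j t ht)).const_smul ((J : ℝ)⁻¹)
  have h2 : (J : ℝ)⁻¹ • ∑ j, enkfRHS A Γ (A udag) (u t) j =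
      -((J : ℝ)⁻¹ • ∑ k,
          gInner Γ (A (ensMean (u t) - udag)) (A (u t k - ensMean (u t))) •
            (u t k - ensMean (u t))) := by
    unfold enkfRHS
    rw [← Finset.smul_sum, Finset.sum_comm, ← smul_neg, ← Finset.sum_neg_distrib,
      Finset.smul_sum]
    congr 1
    refine Finset.sum_congr rfl fun k _ => ?_
    rw [← Finset.sum_smul, smul_smul, gInner_mean_aux hJ, gInner_comm_aux hΓ, neg_smul]
  rw [← h2]
  exact h1

end
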